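/- Let Ω ⊂ ℝ^N be a nonempty bounded convex open set, let q and β be real numbers with 1 < β ≤ q < ∞, let α > 0, and let u : cl(Ω) → ℝ be a continuous function that is not identically zero. Then there exists a constant C > 0 such that for every continuously differentiable function v : ℝ^N → ℝ satisfying the constraint ∫_Ω |u(x)|^α |v(x)|^{β−2} v(x) dx = 0, one has (∫_Ω |v(x)|^q dx)^{1/q} ≤ C (∫_Ω ‖∇v(x)‖^q dx)^{1/q}. -/

import Mathlib

open Real Set MeasureTheory

section helpers

lemma cp_jensen {X : Type*} [MeasurableSpace X] (μ : Measure X) (f : X → ENNReal)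
    (hf : AEMeasurable f μ) (p : ℝ) (hp : 1 < p) :
    (∫⁻ x, f x ∂μ) ^ p ≤ μ univ ^ (p - 1) * ∫⁻ x, f x ^ p ∂μ := by
  have hpq := Real.HolderConjugate.conjExponent hp
  have h := ENNReal.lintegral_mul_le_Lp_mul_Lq μ hpq hf (aemeasurable_const (b := (1:ENNReal)))
  simp only [Pi.mul_apply, mul_one, ENNReal.one_rpow, lintegral_one] at h
  have h2 := ENNReal.rpow_le_rpow h (by linarith : 0 ≤ p)
  refine h2.trans ?_
  rw [ENNReal.mul_rpow_of_nonneg _ _ (by linarith), ← ENNReal.rpow_mul, ← ENNReal.rpow_mul]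
  have e1 : 1 / p * p = 1 := by field_simp
  have e2 : 1 / p.conjExponent * p = p - 1 := by
    rw [Real.conjExponent]; have : p - 1 ≠ 0 := by linarith
    field_simp
  rw [e1, e2, ENNReal.rpow_one, mul_comm]

variable {E : Type*} [NormedAddCommGroup E] [NormedSpace ℝ E]

lemma cp_ftc (v : E → ℝ) (hv : ContDiff ℝ 1 v) (x y : E) (d : ENNReal) (hd : ‖y - x‖ₑ ≤ d)
    (q : ℝ) (hq : 1 < q) :
    ‖v x - v y‖ₑ ^ q ≤ d ^ q * ∫⁻ t in Ioc (0:ℝ) 1, ‖fderiv ℝ v (x + t • (y - x))‖ₑ ^ q := by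
  have hc : Continuous (fderiv ℝ v) := hv.continuous_fderiv (by norm_num)
  have hder : ∀ t ∈ uIcc (0:ℝ) 1, HasDerivAt (fun t : ℝ => v (x + t • (y - x)))
      (fderiv ℝ v (x + t • (y - x)) (y - x)) t := by
    intro t _
    have h1 : HasFDerivAt v (fderiv ℝ v (x + t • (y - x))) (x + t • (y - x)) :=
      (hv.differentiable (by norm_num) _).hasFDerivAt
    have h2 : HasDerivAt (fun t : ℝ => x + t • (y - x)) (y - x) t := by
      simpa using ((hasDerivAt_id t).smul_const (y - x)).const_add x
    exact h1.comp_hasDerivAt t h2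
  have hcont : Continuous fun t : ℝ => fderiv ℝ v (x + t • (y - x)) := by fun_prop
  have hcont2 : Continuous fun t : ℝ => fderiv ℝ v (x + t • (y - x)) (y - x) := by fun_prop
  have h := intervalIntegral.integral_eq_sub_of_hasDerivAt hder (hcont2.intervalIntegrable _ _)
  simp only [one_smul, zero_smul, add_zero, add_sub_cancel] at h
  rw [enorm_sub_rev, ← h, intervalIntegral.integral_of_le zero_le_one]
  have h3 : ‖∫ t in Ioc (0:ℝ) 1, fderiv ℝ v (x + t • (y - x)) (y - x)‖ₑ ≤
      d * ∫⁻ t in Ioc (0:ℝ) 1, ‖fderiv ℝ v (x + t • (y - x))‖ₑ := by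
    refine (enorm_integral_le_lintegral_enorm _).trans ?_
    rw [← lintegral_const_mul _ hcont.enorm.measurable]
    refine lintegral_mono fun t => ?_
    refine (ContinuousLinearMap.le_opENorm _ _).trans ?_
    rw [mul_comm]; gcongr
  refine (ENNReal.rpow_le_rpow h3 (by linarith : 0 ≤ q)).trans ?_
  rw [ENNReal.mul_rpow_of_nonneg _ _ (by linarith)]
  gcongr
  refine (cp_jensen _ _ (by fun_prop) q hq).trans ?_
  simp

variable [MeasurableSpace E] [BorelSpace E] [FiniteDimensional ℝ E] 

lemma cp_change (μ : Measure E) [μ.IsAddHaarMeasure] (Ω : Set E) (hΩ : MeasurableSet Ω) (hc : Convex ℝ Ω) (H : E → ENNReal) (hH : Measurable H)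
   (t : ℝ) (ht : 1/2 ≤ t) (ht1 : t ≤ 1) (x : E) (hx : x ∈ Ω) :
   ∫⁻ y in Ω, H (x + t • (y - x)) ∂μ ≤ 2 ^ (Module.finrank ℝ E) * ∫⁻ y in Ω, H y ∂μ := by
  have h1 : ∫⁻ y in Ω, H (x + t • (y - x)) ∂μ ≤ ∫⁻ y, (Ω.indicator H) (x + t • (y - x)) ∂μ := by
    rw [← lintegral_indicator hΩ]
    refine lintegral_mono fun y => ?_
    by_cases hy : y ∈ Ω
    · have : x + t • (y - x) ∈ Ω := hc.add_smul_sub_mem hx hy ⟨by linarith, ht1⟩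
      simp [hy, this]
    · simp [hy]
  refine h1.trans ?_
  have hHm : Measurable (Ω.indicator H) := hH.indicator hΩ
  have e : ∀ y, x + t • (y - x) = t • y + (x - t • x) := by intro y; module
  simp_rw [e]
  have h2 : ∫⁻ y, (Ω.indicator H) (t • y + (x - t • x)) ∂μ =
     ∫⁻ z, (Ω.indicator H) (z + (x - t • x)) ∂(Measure.map (fun y => t • y) μ) := by
    rw [lintegral_map (by fun_prop) (by fun_prop)]
  rw [h2, Measure.map_addHaar_smul μ (by linarith : t ≠ 0), lintegral_smul_measure,
    lintegral_add_right_eq_self (fun z => Ω.indicator H z), lintegral_indicator hΩ, smul_eq_mul]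
  gcongr
  rw [ENNReal.ofReal_le_iff_le_toReal (by simp)]
  simp only [ENNReal.toReal_pow, ENNReal.toReal_ofNat]
  rw [abs_of_pos (by positivity), ← inv_pow]
  gcongr
  rw [inv_le_comm₀ (by linarith) (by norm_num)]; linarith

lemma cp_t (μ : Measure E) [μ.IsAddHaarMeasure] (Ω : Set E) (hΩ : MeasurableSet Ω) (hc : Convex ℝ Ω) (H : E → ENNReal) (hH : Measurable H)
   (t : ℝ) (ht : 0 ≤ t) (ht1 : t ≤ 1) :
   ∫⁻ x in Ω, ∫⁻ y in Ω, H (x + t • (y - x)) ∂μ ∂μ ≤ μ Ω * (2 ^ (Module.finrank ℝ E) * ∫⁻ y in Ω, H y ∂μ) := by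
  have key : ∀ t : ℝ, 1/2 ≤ t → t ≤ 1 → ∫⁻ x in Ω, ∫⁻ y in Ω, H (x + t • (y - x)) ∂μ ∂μ ≤ μ Ω * (2 ^ (Module.finrank ℝ E) * ∫⁻ y in Ω, H y ∂μ) := by
    intro t ht ht1
    refine (setLIntegral_mono measurable_const fun x hx => cp_change μ Ω hΩ hc H hH t ht ht1 x hx).trans ?_
    rw [setLIntegral_const, mul_comm]
  rcases le_total (1/2) t with h | h
  · exact key t h ht1
  · have hm : Measurable (Function.uncurry fun x y : E => H (x + t • (y - x))) :=
      hH.comp (by fun_prop : Continuous fun p : E × E => p.1 + t • (p.2 - p.1)).measurable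
    rw [lintegral_lintegral_swap hm.aemeasurable]
    refine le_trans (le_of_eq ?_) (key (1 - t) (by linarith) (by linarith))
    congr 1; ext x; congr 1; ext y; congr 1
    module

lemma cp_swap (μ : Measure E) [μ.IsAddHaarMeasure] (Ω : Set E) (hΩ : MeasurableSet Ω)
    (hc : Convex ℝ Ω) (H : E → ENNReal) (hH : Measurable H) :
    ∫⁻ x in Ω, ∫⁻ y in Ω, (∫⁻ t in Ioc (0:ℝ) 1, H (x + t • (y - x))) ∂μ ∂μ ≤
      μ Ω * (2 ^ (Module.finrank ℝ E) * ∫⁻ y in Ω, H y ∂μ) := by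
  have hm3 : Measurable fun p : (E × E) × ℝ => H (p.1.1 + p.2 • (p.1.2 - p.1.1)) :=
    hH.comp (by fun_prop : Continuous fun p : (E × E) × ℝ =>
      p.1.1 + p.2 • (p.1.2 - p.1.1)).measurable
  have hmI : Measurable fun p : E × E => ∫⁻ t in Ioc (0:ℝ) 1, H (p.1 + t • (p.2 - p.1)) :=
    hm3.lintegral_prod_right'
  have e1 : ∫⁻ x in Ω, ∫⁻ y in Ω, (∫⁻ t in Ioc (0:ℝ) 1, H (x + t • (y - x))) ∂μ ∂μ =
      ∫⁻ p, (∫⁻ t in Ioc (0:ℝ) 1, H (p.1 + t • (p.2 - p.1)))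
        ∂((μ.restrict Ω).prod (μ.restrict Ω)) := by
    rw [lintegral_prod _ hmI.aemeasurable]
  have e2 : ∫⁻ p, (∫⁻ t in Ioc (0:ℝ) 1, H (p.1 + t • (p.2 - p.1)))
        ∂((μ.restrict Ω).prod (μ.restrict Ω)) =
      ∫⁻ t in Ioc (0:ℝ) 1, (∫⁻ p, H (p.1 + t • (p.2 - p.1))
        ∂((μ.restrict Ω).prod (μ.restrict Ω))) :=
    lintegral_lintegral_swap (f := fun (p : E × E) (t : ℝ) => H (p.1 + t • (p.2 - p.1)))
      hm3.aemeasurable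
  have e3 : ∫⁻ t in Ioc (0:ℝ) 1, (∫⁻ p, H (p.1 + t • (p.2 - p.1))
        ∂((μ.restrict Ω).prod (μ.restrict Ω))) ≤
      ∫⁻ t in Ioc (0:ℝ) 1, (μ Ω * (2 ^ (Module.finrank ℝ E) * ∫⁻ y in Ω, H y ∂μ)) := by
    refine setLIntegral_mono' measurableSet_Ioc fun t ht => ?_
    have hmt : Measurable fun p : E × E => H (p.1 + t • (p.2 - p.1)) :=
      hm3.comp measurable_prodMk_right
    rw [lintegral_prod _ hmt.aemeasurable]
    exact cp_t μ Ω hΩ hc H hH t ht.1.le ht.2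
  rw [e1, e2]
  refine e3.trans (le_of_eq ?_)
  rw [setLIntegral_const]
  simp

lemma cp_double (μ : Measure E) [μ.IsAddHaarMeasure] (Ω : Set E) (hΩ : MeasurableSet Ω)
    (hc : Convex ℝ Ω) (v : E → ℝ) (hv : ContDiff ℝ 1 v) (d : ENNReal) (hdt : d ≠ ⊤)
    (hd : ∀ x ∈ Ω, ∀ y ∈ Ω, ‖y - x‖ₑ ≤ d) (q : ℝ) (hq : 1 < q) :
    ∫⁻ x in Ω, ∫⁻ y in Ω, ‖v x - v y‖ₑ ^ q ∂μ ∂μ ≤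
      d ^ q * (μ Ω * (2 ^ (Module.finrank ℝ E) * ∫⁻ y in Ω, ‖fderiv ℝ v y‖ₑ ^ q ∂μ)) := by
  have hcf : Continuous (fderiv ℝ v) := hv.continuous_fderiv (by norm_num)
  have hH : Measurable fun y => ‖fderiv ℝ v y‖ₑ ^ q := by fun_prop
  have hpt := fun x y h => cp_ftc v hv x y d h q hq
  have hs := cp_swap μ Ω hΩ hc (fun y => ‖fderiv ℝ v y‖ₑ ^ q) hH
  have hdq : d ^ q ≠ ⊤ := ENNReal.rpow_ne_top_of_nonneg (by linarith) hdt
  refine le_trans ?_ (mul_le_mul_right hs _)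
  rw [← lintegral_const_mul' _ _ hdq]
  refine setLIntegral_mono' hΩ fun x hx => ?_
  rw [← lintegral_const_mul' _ _ hdq]
  exact setLIntegral_mono' hΩ fun y hy => hpt x y (hd x hx y hy)

lemma cp_pt (b : ℝ) (hb : 0 < b) (c s : ℝ) (hc : 0 ≤ c) :
    (c / 2) ^ b - 2 * |s - c| ^ b ≤ |s| ^ (b - 1) * s := by
  have e : 0 ≤ s → |s| ^ (b - 1) * s = s ^ b := by
    intro hs
    rcases hs.eq_or_lt with rfl | hs
    · simp [hb.ne']
    · rw [abs_of_pos hs, Real.rpow_sub_one hs.ne']; field_simp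
  have e' : s < 0 → |s| ^ (b - 1) * s = - (-s) ^ b := by
    intro hs
    rw [abs_of_neg hs, Real.rpow_sub_one (by linarith)]; have := hs.ne; field_simp
  rcases le_total (c / 2) s with h | h
  · rw [e (by linarith)]
    have := Real.rpow_le_rpow (by linarith) h hb.le
    have : 0 ≤ |s - c| ^ b := by positivity
    linarith
  · have h1 : (c / 2) ^ b ≤ |s - c| ^ b :=
      Real.rpow_le_rpow (by linarith) (by rw [abs_of_nonpos] <;> linarith) hb.le
    rcases le_or_gt 0 s with hs | hs
    · rw [e hs]
      have : 0 ≤ s ^ b := by positivity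
      have : 0 ≤ |s - c| ^ b := by positivity
      linarith
    · rw [e' hs]
      have : (-s) ^ b ≤ |s - c| ^ b :=
        Real.rpow_le_rpow (by linarith) (by rw [abs_of_nonpos] <;> linarith) hb.le
      linarith

lemma cp_real (Ω : Set E) (μ : Measure E) [μ.IsAddHaarMeasure] (hb : Bornology.IsBounded Ω)
    (hΩ : MeasurableSet Ω) (w : E → ℝ) (hw : ContinuousOn w (closure Ω)) (hw0 : ∀ x, 0 ≤ w x)
    (M : ℝ) (hM : ∀ x ∈ Ω, w x ≤ M) (b : ℝ) (hb0 : 0 < b) (v : E → ℝ) (hv : Continuous v)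
    (h0 : ∫ x in Ω, w x * (|v x| ^ (b - 1) * v x) ∂μ = 0) (c : ℝ) (hc : 0 ≤ c) :
    (∫ x in Ω, w x ∂μ) * (c / 2) ^ b ≤ 2 * M * ∫ x in Ω, |v x - c| ^ b ∂μ := by
  have hcomp : IsCompact (closure Ω) := hb.isCompact_closure
  have hfin : μ Ω ≠ ⊤ := hb.measure_lt_top.ne
  have int : ∀ f : E → ℝ, ContinuousOn f (closure Ω) → IntegrableOn f Ω μ := fun f hf =>
    (hf.integrableOn_compact hcomp).mono_set subset_closure
  have hvb : Continuous fun x => |v x - c| ^ b := by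
    refine Continuous.rpow_const (by fun_prop) fun _ => Or.inr hb0.le
  have iw := int w hw
  have iv := int _ hvb.continuousOn
  have iwv : IntegrableOn (fun x => w x * |v x - c| ^ b) Ω μ := int _ (hw.mul hvb.continuousOn)
  have gabs : ∀ s : ℝ, |(|s| ^ (b - 1) * s)| = |s| ^ b := by
    intro s
    rcases eq_or_ne s 0 with rfl | hs
    · simp [hb0.ne']
    · have : |s| ≠ 0 := by simpa using hs
      rw [abs_mul, abs_of_nonneg (by positivity), Real.rpow_sub_one this]; field_simp
  have ig : IntegrableOn (fun x => w x * (|v x| ^ (b - 1) * v x)) Ω μ := by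
    have i1 : IntegrableOn (fun x => w x * |v x| ^ b) Ω μ := int _ (hw.mul
      (Continuous.rpow_const (by fun_prop) fun _ => Or.inr hb0.le).continuousOn)
    refine Integrable.mono' i1 ?_ ?_
    · refine iw.aestronglyMeasurable.mul ?_
      have := hv.measurable
      exact Measurable.aestronglyMeasurable (by fun_prop)
    · refine Filter.Eventually.of_forall fun x => ?_
      rw [norm_mul, Real.norm_eq_abs, Real.norm_eq_abs, gabs, abs_of_nonneg (hw0 x)]
  have h1 : ∫ x in Ω, (w x * (c / 2) ^ b - 2 * (w x * |v x - c| ^ b)) ∂μ ≤ 0 := by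
    rw [← h0]
    refine integral_mono ((iw.mul_const _).sub (iwv.const_mul 2)) ig fun x => ?_
    have := mul_le_mul_of_nonneg_left (cp_pt b hb0 c (v x) hc) (hw0 x)
    simp only; linarith
  rw [integral_sub (iw.mul_const _) (iwv.const_mul 2), integral_mul_const, integral_const_mul] at h1
  have h2 : ∫ x in Ω, w x * |v x - c| ^ b ∂μ ≤ ∫ x in Ω, M * |v x - c| ^ b ∂μ := by
    refine setIntegral_mono_on iwv (iv.const_mul M) hΩ fun x hx => ?_
    exact mul_le_mul_of_nonneg_right (hM x hx) (by positivity)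
  rw [integral_const_mul] at h2
  linarith

lemma cp_real' (Ω : Set E) (μ : Measure E) [μ.IsAddHaarMeasure] (hb : Bornology.IsBounded Ω)
    (hΩ : MeasurableSet Ω) (w : E → ℝ) (hw : ContinuousOn w (closure Ω)) (hw0 : ∀ x, 0 ≤ w x)
    (M : ℝ) (hM : ∀ x ∈ Ω, w x ≤ M) (b : ℝ) (hb0 : 0 < b) (v : E → ℝ) (hv : Continuous v)
    (h0 : ∫ x in Ω, w x * (|v x| ^ (b - 1) * v x) ∂μ = 0) (c : ℝ) :
    (∫ x in Ω, w x ∂μ) * (|c| / 2) ^ b ≤ 2 * M * ∫ x in Ω, |v x - c| ^ b ∂μ := by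
  rcases le_total 0 c with hc | hc
  · rw [abs_of_nonneg hc]
    exact cp_real Ω μ hb hΩ w hw hw0 M hM b hb0 v hv h0 c hc
  · rw [abs_of_nonpos hc]
    have := cp_real Ω μ hb hΩ w hw hw0 M hM b hb0 (fun x => - v x) hv.neg
      (by simpa [integral_neg] using h0) (-c) (by linarith)
    have e : ∀ x, |(- v x) - (-c)| = |v x - c| := by
      intro x; rw [← abs_neg]; ring_nf
    simpa only [e] using this

lemma cp_enn (Ω : Set E) (μ : Measure E) [μ.IsAddHaarMeasure] (hb : Bornology.IsBounded Ω)
    (hΩ : MeasurableSet Ω) (w : E → ℝ) (hw : ContinuousOn w (closure Ω)) (hw0 : ∀ x, 0 ≤ w x)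
    (hW : 0 < ∫ x in Ω, w x ∂μ) (b q : ℝ) (hb0 : 0 < b) (hbq : b < q) :
    ∃ K : ENNReal, K ≠ ⊤ ∧ ∀ v : E → ℝ, Continuous v →
      ∫ x in Ω, w x * (|v x| ^ (b - 1) * v x) ∂μ = 0 → ∀ c : ℝ,
      ‖c‖ₑ ^ q ≤ K * ∫⁻ x in Ω, ‖c - v x‖ₑ ^ q ∂μ := by
  have hcomp : IsCompact (closure Ω) := hb.isCompact_closure
  have hfin : μ Ω ≠ ⊤ := hb.measure_lt_top.ne
  obtain ⟨M0, hM0⟩ := hcomp.exists_bound_of_continuousOn hw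
  set M := max M0 0
  have hM : ∀ x ∈ Ω, w x ≤ M := fun x hx =>
    ((le_abs_self _).trans (hM0 x (subset_closure hx))).trans (le_max_left _ _)
  have hMnn : 0 ≤ M := le_max_right _ _
  set W := ∫ x in Ω, w x ∂μ
  have hp : 1 < q / b := by rwa [one_lt_div hb0]
  set A := 2 ^ b * (2 * M) / W
  have hA : 0 ≤ A := by positivity
  refine ⟨ENNReal.ofReal A ^ (q / b) * μ Ω ^ (q / b - 1), ?_, ?_⟩
  · refine ENNReal.mul_ne_top ?_ ?_
    · exact ENNReal.rpow_ne_top_of_nonneg (by linarith) ENNReal.ofReal_ne_top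
    · exact ENNReal.rpow_ne_top_of_nonneg (by linarith) hfin
  intro v hv h0 c
  have h1 := cp_real' Ω μ hb hΩ w hw hw0 M hM b hb0 v hv h0 c
  have hvb : Continuous fun x => |v x - c| ^ b := by
    refine Continuous.rpow_const (by fun_prop) fun _ => Or.inr hb0.le
  have iv : IntegrableOn (fun x => |v x - c| ^ b) Ω μ :=
    (hvb.continuousOn.integrableOn_compact hcomp).mono_set subset_closure
  have h2 : |c| ^ b ≤ A * ∫ x in Ω, |v x - c| ^ b ∂μ := by
    rw [Real.div_rpow (abs_nonneg _) (by norm_num)] at h1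
    have h2b : (0:ℝ) < 2 ^ b := by positivity
    have : |c| ^ b = (2 ^ b / W) * (W * (|c| ^ b / 2 ^ b)) := by
      have : W ≠ 0 := hW.ne'
      field_simp
    rw [this]
    refine (mul_le_mul_of_nonneg_left h1 (by positivity)).trans (le_of_eq ?_)
    simp only [A]; ring
  have en : ∀ s : ℝ, ENNReal.ofReal (|s| ^ b) = ‖s‖ₑ ^ b := by
    intro s
    rw [← ENNReal.ofReal_rpow_of_nonneg (abs_nonneg _) hb0.le, Real.enorm_eq_ofReal_abs]
  have h3 : ‖c‖ₑ ^ b ≤ ENNReal.ofReal A * ∫⁻ x in Ω, ‖c - v x‖ₑ ^ b ∂μ := by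
    have := ENNReal.ofReal_le_ofReal h2
    rw [ENNReal.ofReal_mul hA, ofReal_integral_eq_lintegral_ofReal iv
      (Filter.Eventually.of_forall fun x => by positivity)] at this
    simp only [en] at this
    simpa only [enorm_sub_rev] using this
  have h4 := ENNReal.rpow_le_rpow h3 (by linarith : 0 ≤ q / b)
  have e : b * (q / b) = q := by field_simp
  rw [← ENNReal.rpow_mul, e, ENNReal.mul_rpow_of_nonneg _ _ (by linarith)] at h4
  refine h4.trans ?_
  rw [mul_assoc]
  refine mul_le_mul_right ?_ _
  have hm := hv.measurable
  have h5 := cp_jensen (μ.restrict Ω) (fun x => ‖c - v x‖ₑ ^ b) (by fun_prop) (q / b) hp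
  simpa only [← ENNReal.rpow_mul, e, Measure.restrict_apply_univ] using h5

end helpers

/-- Lemma 2.2: constrained Poincaré inequality. For `1 < β ≤ q`, `α > 0` and a continuous
weight `u ≢ 0` on `cl Ω`, there is `C > 0` such that every `C¹` function `v` with
`∫_Ω |u|^α |v|^{β-2} v = 0` satisfies `‖v‖_{L^q(Ω)} ≤ C ‖∇v‖_{L^q(Ω)}`. -/
theorem constrained_poincare (N : ℕ) (Ω : Set (EuclideanSpace ℝ (Fin N)))
    (hne : Ω.Nonempty) (hb : Bornology.IsBounded Ω) (hconv : Convex ℝ Ω)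
    (ho : IsOpen Ω)
    (q β α : ℝ) (hβ : 1 < β) (hβq : β ≤ q) (hα : 0 < α)
    (u : EuclideanSpace ℝ (Fin N) → ℝ) (hu : ContinuousOn u (closure Ω))
    (hu0 : ∃ x ∈ closure Ω, u x ≠ 0) :
    ∃ C : ℝ, 0 < C ∧
      ∀ v : EuclideanSpace ℝ (Fin N) → ℝ, ContDiff ℝ 1 v →
        (∫ x in Ω, |u x| ^ α * (|v x| ^ (β - 2) * v x) = 0) →
        (∫ x in Ω, |v x| ^ q) ^ (1 / q) ≤
          C * (∫ x in Ω, ‖fderiv ℝ v x‖ ^ q) ^ (1 / q) := by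
  have hq : 1 < q := by linarith
  have hcomp : IsCompact (closure Ω) := hb.isCompact_closure
  have hΩ := ho.measurableSet
  have hw : ContinuousOn (fun x => |u x| ^ α) (closure Ω) :=
    hu.abs.rpow_const fun _ _ => Or.inr hα.le
  have int : ∀ f : EuclideanSpace ℝ (Fin N) → ℝ, ContinuousOn f (closure Ω) →
      IntegrableOn f Ω := fun f hf =>
    (hf.integrableOn_compact hcomp).mono_set subset_closure
  have hW : 0 < ∫ x in Ω, |u x| ^ α := by
    obtain ⟨z, hz, hz0⟩ := hu0
    rw [setIntegral_pos_iff_support_of_nonneg_ae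
      (Filter.Eventually.of_forall fun x => by positivity) (int _ hw)]
    have h1 : ∃ x ∈ Ω, u x ≠ 0 := by
      by_contra! h
      have h2 : u z ∈ closure {(0:ℝ)} := by
        refine ContinuousWithinAt.mem_closure (s := Ω) ((hu z hz).mono subset_closure) hz ?_
        intro x hx; simp [h x hx]
      simp at h2; exact hz0 h2
    obtain ⟨x, hx, hx0⟩ := h1
    have hop : IsOpen (Ω ∩ u ⁻¹' {0}ᶜ) :=
      (hu.mono subset_closure).isOpen_inter_preimage ho isOpen_compl_singleton
    refine (hop.measure_pos volume ⟨x, hx, hx0⟩).trans_le (measure_mono ?_)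
    rintro y ⟨hy, hy0⟩
    refine ⟨?_, hy⟩
    have : 0 < |u y| := abs_pos.mpr hy0
    exact (Real.rpow_pos_of_pos this α).ne'
  obtain ⟨K, hK, hKv⟩ := cp_enn Ω volume hb hΩ (fun x => |u x| ^ α) hw (fun x => by positivity) hW
    (β - 1) q (by linarith) (by linarith)
  set d : ENNReal := Metric.ediam Ω
  have hd : ∀ x ∈ Ω, ∀ y ∈ Ω, ‖y - x‖ₑ ≤ d := fun x hx y hy => by
    rw [← edist_eq_enorm_sub]; exact Metric.edist_le_ediam_of_mem hy hx
  have hdt : d ≠ ⊤ := hb.ediam_ne_top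
  set L : ENNReal := K * (d ^ q * (volume Ω * 2 ^ (Module.finrank ℝ (EuclideanSpace ℝ (Fin N)))))
  have hL : L ≠ ⊤ := by
    refine ENNReal.mul_ne_top hK (ENNReal.mul_ne_top ?_ (ENNReal.mul_ne_top hb.measure_lt_top.ne ?_))
    · exact ENNReal.rpow_ne_top_of_nonneg (by linarith) hdt
    · simp
  have hLr : 0 < L.toReal + 1 := by positivity
  refine ⟨(L.toReal + 1) ^ (1 / q), Real.rpow_pos_of_pos hLr _, ?_⟩
  intro v hv h0
  have hcf : Continuous (fderiv ℝ v) := hv.continuous_fderiv (by norm_num)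
  have hvc := hv.continuous
  have h1 := hKv v hvc (by rw [← h0]; ring_nf)
  have iv : IntegrableOn (fun x => |v x| ^ q) Ω :=
    int _ (Continuous.rpow_const (by fun_prop) fun _ => Or.inr (by linarith)).continuousOn
  have idv : IntegrableOn (fun x => ‖fderiv ℝ v x‖ ^ q) Ω :=
    int _ (Continuous.rpow_const (by fun_prop) fun _ => Or.inr (by linarith)).continuousOn
  have key : ∫⁻ x in Ω, ‖v x‖ₑ ^ q ≤ L * ∫⁻ x in Ω, ‖fderiv ℝ v x‖ₑ ^ q := by
    calc _ ≤ ∫⁻ y in Ω, K * ∫⁻ x in Ω, ‖v y - v x‖ₑ ^ q := lintegral_mono fun y => h1 (v y)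
      _ = K * ∫⁻ y in Ω, ∫⁻ x in Ω, ‖v y - v x‖ₑ ^ q := lintegral_const_mul' _ _ hK
      _ ≤ K * _ := mul_le_mul_right (cp_double volume Ω hΩ hconv v hv d hdt hd q hq) _
      _ = _ := by simp only [L]; ring
  have e1 : ENNReal.ofReal (∫ x in Ω, |v x| ^ q) = ∫⁻ x in Ω, ‖v x‖ₑ ^ q := by
    rw [ofReal_integral_eq_lintegral_ofReal iv (Filter.Eventually.of_forall fun x => by positivity)]
    congr 1; ext x
    rw [← ENNReal.ofReal_rpow_of_nonneg (abs_nonneg _) (by linarith), Real.enorm_eq_ofReal_abs]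
  have e2 : ENNReal.ofReal (∫ x in Ω, ‖fderiv ℝ v x‖ ^ q) = ∫⁻ x in Ω, ‖fderiv ℝ v x‖ₑ ^ q := by
    rw [ofReal_integral_eq_lintegral_ofReal idv (Filter.Eventually.of_forall fun x => by positivity)]
    congr 1; ext x
    rw [← ENNReal.ofReal_rpow_of_nonneg (norm_nonneg _) (by linarith), ofReal_norm]
  have hI : 0 ≤ ∫ x in Ω, ‖fderiv ℝ v x‖ ^ q := integral_nonneg fun x => by positivity
  have hI' : 0 ≤ ∫ x in Ω, |v x| ^ q := integral_nonneg fun x => by positivity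
  rw [← e1, ← e2, ← ENNReal.ofReal_toReal hL, ← ENNReal.ofReal_mul ENNReal.toReal_nonneg,
    ENNReal.ofReal_le_ofReal_iff (by positivity)] at key
  rw [← Real.mul_rpow hLr.le hI]
  refine Real.rpow_le_rpow hI' ?_ (by positivity)
  linarith
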